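/- Let 0 < α < 1 and 1 < p < ∞. There exists a constant c > 0 such that for every f ∈ Λ_α(ℝ) and all bounded self-adjoint operators A and B on a separable Hilbert space with A − B ∈ S_p, the operator f(A) − f(B) belongs to S_{p/α} and ‖f(A) − f(B)‖_{S_{p/α}} ≤ c · ‖f‖_{Λ_α(ℝ)} · ‖A − B‖_{S_p}^α. -/

import Mathlib

open scoped BigOperators
noncomputable section

/-- The `j`-th singular value of a bounded operator `T` on a Hilbert space:
`s_j(T) = inf {‖T - R‖ : rank R ≤ j}`. -/
def sVal {H : Type} [NormedAddCommGroup H] [InnerProductSpace ℂ H] [CompleteSpace H]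
    (T : H →L[ℂ] H) (j : ℕ) : ℝ :=
  sInf {c : ℝ | ∃ R : H →L[ℂ] H, LinearMap.rank (R : H →ₗ[ℂ] H) ≤ (j : Cardinal) ∧ c = ‖T - R‖}

/-- Membership in the Schatten–von Neumann class `S_p`. -/
def MemSchatten {H : Type} [NormedAddCommGroup H] [InnerProductSpace ℂ H] [CompleteSpace H]
    (p : ℝ) (T : H →L[ℂ] H) : Prop :=
  Summable fun j : ℕ => sVal T j ^ p

/-- The Schatten–von Neumann norm `‖T‖_{S_p} = (∑_{j ≥ 0} s_j(T)^p)^{1/p}`. -/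
def schNorm {H : Type} [NormedAddCommGroup H] [InnerProductSpace ℂ H] [CompleteSpace H]
    (p : ℝ) (T : H →L[ℂ] H) : ℝ :=
  (∑' j : ℕ, sVal T j ^ p) ^ (1 / p)

/-- `f` satisfies the Hölder condition of order `α` with constant `C`. -/
def HoelderWith (C α : ℝ) (f : ℝ → ℂ) : Prop :=
  ∀ x y : ℝ, ‖f x - f y‖ ≤ C * |x - y| ^ α

/-- The Hölder norm `‖f‖_{Λ_α(ℝ)} = sup_{x ≠ y} |f(x) - f(y)|/|x - y|^α`, realized as the least
admissible Hölder constant. -/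
def hoelderNorm (α : ℝ) (f : ℝ → ℂ) : ℝ :=
  sInf {C : ℝ | 0 ≤ C ∧ HoelderWith C α f}

/-- Membership in the Hölder class `Λ_α(ℝ)`. -/
def MemHoelder (α : ℝ) (f : ℝ → ℂ) : Prop := ∃ C : ℝ, 0 ≤ C ∧ HoelderWith C α f

/-- `f(A)` for a bounded self-adjoint operator `A` (whose spectrum is real), via the continuous
functional calculus. -/
def opFun {H : Type} [NormedAddCommGroup H] [InnerProductSpace ℂ H] [CompleteSpace H]
    (f : ℝ → ℂ) (A : H →L[ℂ] H) : H →L[ℂ] H :=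
  cfc (fun z : ℂ => f z.re) A

section SchattenHoelder

open MeasureTheory
open scoped InnerProductSpace

set_option linter.unusedSectionVars false

variable {H : Type} [NormedAddCommGroup H] [InnerProductSpace ℂ H] [CompleteSpace H]

/-! ### Singular values -/

lemma sVal_le_norm_sub (T : H →L[ℂ] H) {j : ℕ} (R : H →L[ℂ] H)
    (hR : LinearMap.rank (R : H →ₗ[ℂ] H) ≤ (j : Cardinal)) : sVal T j ≤ ‖T - R‖ :=
  csInf_le ⟨0, by rintro _ ⟨R, -, rfl⟩; exact norm_nonneg _⟩ ⟨R, hR, rfl⟩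

lemma rank_zero_clm_le (j : ℕ) :
    LinearMap.rank ((0 : H →L[ℂ] H) : H →ₗ[ℂ] H) ≤ (j : Cardinal) := by
  simp

lemma sVal_nonneg (T : H →L[ℂ] H) (j : ℕ) : 0 ≤ sVal T j :=
  Real.sInf_nonneg (by rintro _ ⟨R, -, rfl⟩; exact norm_nonneg _)

lemma exists_rank_le_norm_sub_lt (T : H →L[ℂ] H) (j : ℕ) {ε : ℝ} (hε : 0 < ε) :
    ∃ R : H →L[ℂ] H, LinearMap.rank (R : H →ₗ[ℂ] H) ≤ (j : Cardinal) ∧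
      ‖T - R‖ < sVal T j + ε := by
  obtain ⟨_, ⟨R, hR, rfl⟩, h⟩ := exists_lt_of_csInf_lt
    (s := {c : ℝ | ∃ R : H →L[ℂ] H,
      LinearMap.rank (R : H →ₗ[ℂ] H) ≤ (j : Cardinal) ∧ c = ‖T - R‖})
    ⟨_, 0, rank_zero_clm_le j, rfl⟩ (lt_add_of_pos_right (sVal T j) hε)
  exact ⟨R, hR, h⟩

lemma sVal_antitone (T : H →L[ℂ] H) : Antitone (sVal T) := by
  intro i j hij
  refine le_csInf ⟨_, 0, rank_zero_clm_le i, rfl⟩ ?_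
  rintro _ ⟨R, hR, rfl⟩
  exact sVal_le_norm_sub T R (hR.trans (by exact_mod_cast hij))

/-- `c` bounds the `n`-th Ky Fan functional of `T`. -/
def KyFanLE (n : ℕ) (T : H →L[ℂ] H) (c : ℝ) : Prop :=
  ∀ x y : Fin n → H, Orthonormal ℂ x → Orthonormal ℂ y → ∑ k, ‖⟪y k, T (x k)⟫_ℂ‖ ≤ c

lemma KyFanLE.add {n : ℕ} {S T : H →L[ℂ] H} {a b : ℝ} (hS : KyFanLE n S a)
    (hT : KyFanLE n T b) : KyFanLE n (S + T) (a + b) := by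
  intro x y hx hy
  refine le_trans ?_ (add_le_add (hS x y hx hy) (hT x y hx hy))
  rw [← Finset.sum_add_distrib]
  refine Finset.sum_le_sum fun k _ => ?_
  rw [add_apply, inner_add_right]
  exact norm_add_le _ _

lemma KyFanLE.mono {n : ℕ} {T : H →L[ℂ] H} {a b : ℝ} (hT : KyFanLE n T a) (h : a ≤ b) :
    KyFanLE n T b :=
  fun x y hx hy => (hT x y hx hy).trans h

lemma kyFanLE_of_norm_le {n : ℕ} {T : H →L[ℂ] H} {a : ℝ} (hT : ‖T‖ ≤ a) :
    KyFanLE n T (n * a) := by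
  intro x y hx hy
  calc ∑ k, ‖⟪y k, T (x k)⟫_ℂ‖ ≤ ∑ _k : Fin n, a := by
        refine Finset.sum_le_sum fun k _ => ?_
        calc ‖⟪y k, T (x k)⟫_ℂ‖ ≤ ‖y k‖ * ‖T (x k)‖ := norm_inner_le_norm _ _
          _ ≤ 1 * (‖T‖ * ‖x k‖) := by
            rw [hy.1 k]; gcongr; exact T.le_opNorm _
          _ ≤ a := by rw [hx.1 k]; simpa using hT
    _ = n * a := by simp

lemma orthonormal_cons {n : ℕ} {x : Fin n → H} (hx : Orthonormal ℂ x) {w : H} (hw : ‖w‖ = 1)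
    (hxw : ∀ k, ⟪x k, w⟫_ℂ = 0) : Orthonormal ℂ (Fin.cons w x : Fin (n + 1) → H) := by
  refine ⟨fun i => ?_, fun i j hij => ?_⟩
  · refine Fin.cases ?_ (fun k => ?_) i
    · simpa using hw
    · simpa using hx.1 k
  · revert hij
    refine Fin.cases ?_ (fun k => ?_) i <;> refine Fin.cases ?_ (fun l => ?_) j
    · simp
    · intro _
      simpa using inner_eq_zero_symm.1 (hxw l)
    · intro _
      simpa using hxw k
    · intro hkl
      simpa using hx.2 (fun h => hkl (by rw [h]))

instance finiteDimensional_span_range_fin {n : ℕ} (x : Fin n → H) :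
    FiniteDimensional ℂ (Submodule.span ℂ (Set.range x)) :=
  FiniteDimensional.span_of_finite ℂ (Set.finite_range x)

lemma rank_starProjection_le {n : ℕ} (x : Fin n → H) :
    LinearMap.rank (((Submodule.span ℂ (Set.range x)).starProjection : H →L[ℂ] H) : H →ₗ[ℂ] H)
      ≤ (n : Cardinal) := by
  have h : LinearMap.range
      (((Submodule.span ℂ (Set.range x)).starProjection : H →L[ℂ] H) : H →ₗ[ℂ] H)
      = Submodule.span ℂ (Set.range x) := by
    simp
  rw [LinearMap.rank, h]
  refine (rank_span_le _).trans ?_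
  simpa using Cardinal.mk_range_le (f := x)

lemma exists_orthonormal_of_lt_sVal (T : H →L[ℂ] H) {c : ℝ} (hc : 0 ≤ c) (n : ℕ)
    (h : ∀ k < n, c < sVal T (2 * k)) :
    ∃ x y : Fin n → H, Orthonormal ℂ x ∧ Orthonormal ℂ y ∧ ∀ k, c ≤ ‖⟪y k, T (x k)⟫_ℂ‖ := by
  induction n with
  | zero => exact ⟨Fin.elim0, Fin.elim0, by simp [Orthonormal, Pairwise],
      by simp [Orthonormal, Pairwise], fun k => k.elim0⟩
  | succ n ih =>
    obtain ⟨x, y, hx, hy, hxy⟩ := ih fun k hk => h k (hk.trans n.lt_succ_self)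
    set P := (Submodule.span ℂ (Set.range x)).starProjection with hP
    set Q := (Submodule.span ℂ (Set.range y)).starProjection with hQ
    have hrank : LinearMap.rank ((Q * T + (1 - Q) * T * P : H →L[ℂ] H) : H →ₗ[ℂ] H)
        ≤ ((2 * n : ℕ) : Cardinal) := by
      have h1 : LinearMap.rank ((Q * T : H →L[ℂ] H) : H →ₗ[ℂ] H) ≤ (n : Cardinal) :=
        (LinearMap.rank_comp_le_left (T : H →ₗ[ℂ] H) (Q : H →ₗ[ℂ] H)).trans
          (rank_starProjection_le y)
      have h2 : LinearMap.rank (((1 - Q) * T * P : H →L[ℂ] H) : H →ₗ[ℂ] H) ≤ (n : Cardinal) :=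
        (LinearMap.rank_comp_le_right (P : H →ₗ[ℂ] H)
          (((1 - Q) * T : H →L[ℂ] H) : H →ₗ[ℂ] H)).trans (rank_starProjection_le x)
      refine (LinearMap.rank_add_le _ _).trans ((add_le_add h1 h2).trans ?_)
      rw [two_mul]; push_cast; exact le_rfl
    have hlt : c < ‖(1 - Q) * T * (1 - P)‖ := by
      refine (h n n.lt_succ_self).trans_le ((sVal_le_norm_sub T _ hrank).trans_eq ?_)
      congr 1
      noncomm_ring
    obtain ⟨v, hv⟩ : ∃ v, c * ‖v‖ < ‖((1 - Q) * T * (1 - P)) v‖ := by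
      by_contra! hcon
      exact absurd (ContinuousLinearMap.opNorm_le_bound _ hc hcon) (not_le.2 hlt)
    set w := v - P v with hw
    set z := T w - Q (T w) with hz
    have hzv : ((1 - Q) * T * (1 - P)) v = z := by
      simp [hz, hw]
    rw [hzv] at hv
    have hwv : ‖w‖ ≤ ‖v‖ := by
      have hw' : w = (Submodule.span ℂ (Set.range x))ᗮ.starProjection v := by
        rw [Submodule.starProjection_orthogonal_val]
      rw [hw']
      exact Submodule.norm_starProjection_apply_le _ _
    have hz0 : 0 < ‖z‖ := lt_of_le_of_lt (by positivity) hv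
    have hw0 : 0 < ‖w‖ := by
      rw [norm_pos_iff]
      intro h0
      rw [hz, h0] at hz0
      simp at hz0
    have hxw : ∀ k, ⟪x k, w⟫_ℂ = 0 := fun k =>
      Submodule.inner_right_of_mem_orthogonal (Submodule.subset_span (Set.mem_range_self k))
        (Submodule.sub_starProjection_mem_orthogonal v)
    have hyz : ∀ k, ⟪y k, z⟫_ℂ = 0 := fun k =>
      Submodule.inner_right_of_mem_orthogonal (Submodule.subset_span (Set.mem_range_self k))
        (Submodule.sub_starProjection_mem_orthogonal (T w))
    have hzT : ⟪z, T w⟫_ℂ = (‖z‖ : ℂ) ^ 2 := by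
      have h1 : T w = z + Q (T w) := by simp [hz]
      have h2 : ⟪z, Q (T w)⟫_ℂ = 0 :=
        Submodule.inner_left_of_mem_orthogonal (Submodule.starProjection_apply_mem _ _)
          (Submodule.sub_starProjection_mem_orthogonal (T w))
      conv_lhs => rw [h1]
      rw [inner_add_right, h2, add_zero, inner_self_eq_norm_sq_to_K]
      rfl
    refine ⟨Fin.cons (((‖w‖ : ℂ)⁻¹) • w) x, Fin.cons (((‖z‖ : ℂ)⁻¹) • z) y,
      orthonormal_cons hx ?_ ?_, orthonormal_cons hy ?_ ?_, ?_⟩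
    · rw [norm_smul]; simp [hw0.ne']
    · intro k; rw [inner_smul_right, hxw, mul_zero]
    · rw [norm_smul]; simp [hz0.ne']
    · intro k; rw [inner_smul_right, hyz, mul_zero]
    · intro k
      refine Fin.cases ?_ (fun k => ?_) k
      · simp only [Fin.cons_zero, map_smul, inner_smul_left, inner_smul_right, hzT]
        have : c ≤ ‖z‖ / ‖w‖ := by
          rw [le_div_iff₀ hw0]
          exact (mul_le_mul_of_nonneg_left hwv hc).trans hv.le
        refine this.trans_eq ?_
        simp
        field_simp
      · simpa using hxy k

lemma KyFanLE.sVal_le {n : ℕ} {T : H →L[ℂ] H} {c : ℝ} (hc : 0 ≤ c)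
    (hT : KyFanLE (n + 1) T c) : sVal T (2 * n) ≤ c / (n + 1) := by
  refine le_of_forall_lt_imp_le_of_dense fun b hb => ?_
  rcases lt_or_ge b 0 with hb0 | hb0
  · exact hb0.le.trans (by positivity)
  obtain ⟨x, y, hx, hy, hxy⟩ := exists_orthonormal_of_lt_sVal T hb0 (n + 1) fun k hk =>
    hb.trans_le (sVal_antitone T (by omega))
  rw [le_div_iff₀ (by positivity)]
  calc b * (n + 1) = ∑ _k : Fin (n + 1), b := by simp; ring
    _ ≤ _ := Finset.sum_le_sum fun k _ => hxy k
    _ ≤ c := hT x y hx hy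

/-! ### Finite-rank operators as sums of rank-one operators -/

/-- `D` is a finite sum of rank-one operators of total cost at most `c`. -/
def NuclearLE (D : H →L[ℂ] H) (c : ℝ) : Prop :=
  ∃ (ι : Type) (_ : Fintype ι) (u v : ι → H), (∀ x, D x = ∑ i, ⟪v i, x⟫_ℂ • u i) ∧
    ∑ i, (‖u i‖ ^ 2 + ‖v i‖ ^ 2) / 2 ≤ c

lemma nuclearLE_zero : NuclearLE (0 : H →L[ℂ] H) 0 :=
  ⟨Empty, inferInstance, Empty.elim, Empty.elim, by simp, by simp⟩

lemma NuclearLE.add {S T : H →L[ℂ] H} {a b : ℝ} (hS : NuclearLE S a) (hT : NuclearLE T b) :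
    NuclearLE (S + T) (a + b) := by
  obtain ⟨ι, _, u, v, h, hc⟩ := hS
  obtain ⟨κ, _, u', v', h', hc'⟩ := hT
  refine ⟨ι ⊕ κ, inferInstance, Sum.elim u u', Sum.elim v v', fun x => ?_, ?_⟩
  · simp [h, h']
  · simpa using add_le_add hc hc'

lemma NuclearLE.mono {T : H →L[ℂ] H} {a b : ℝ} (hT : NuclearLE T a) (h : a ≤ b) :
    NuclearLE T b := by
  obtain ⟨ι, i, u, v, h', hc⟩ := hT
  exact ⟨ι, i, u, v, h', hc.trans h⟩

lemma nuclearLE_of_rank_le {W : H →L[ℂ] H} {r : ℕ} {a : ℝ} (ha : 0 < a)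
    (hr : LinearMap.rank (W : H →ₗ[ℂ] H) ≤ (r : Cardinal)) (hW : ‖W‖ ≤ a) :
    NuclearLE W (r * a) := by
  set V := LinearMap.range (W : H →ₗ[ℂ] H) with hV
  have hVr : Module.rank ℂ V ≤ (r : Cardinal) := hr
  have : FiniteDimensional ℂ V :=
    Module.rank_lt_aleph0_iff.1 (hVr.trans_lt (Cardinal.natCast_lt_aleph0))
  have hfin : Module.finrank ℂ V ≤ r := Module.finrank_le_of_rank_le hVr
  set e := stdOrthonormalBasis ℂ V with he
  have hs : (0 : ℝ) < √a := Real.sqrt_pos.2 ha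
  have hs2 : √a ^ 2 = a := Real.sq_sqrt ha.le
  refine ⟨Fin (Module.finrank ℂ V), inferInstance, fun i => (√a : ℂ) • (e i : H),
    fun i => ((√a : ℂ)⁻¹) • (ContinuousLinearMap.adjoint W) (e i : H), fun x => ?_, ?_⟩
  · have h := e.sum_repr' ⟨W x, LinearMap.mem_range_self (W : H →ₗ[ℂ] H) x⟩
    have h' := congrArg (Subtype.val) h
    simp only [Submodule.coe_sum, Submodule.coe_smul, Submodule.coe_inner] at h'
    rw [← h']
    refine Finset.sum_congr rfl fun i _ => ?_
    rw [inner_smul_left, ContinuousLinearMap.adjoint_inner_left, smul_smul]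
    congr 1
    have : (√a : ℂ) ≠ 0 := by exact_mod_cast hs.ne'
    simp
    field_simp
  · calc _ ≤ ∑ _i : Fin (Module.finrank ℂ V), a := by
          refine Finset.sum_le_sum fun i _ => ?_
          have he1 : ‖(e i : H)‖ = 1 := e.norm_eq_one i
          have h1 : ‖(ContinuousLinearMap.adjoint W) (e i : H)‖ ≤ a := by
            refine (ContinuousLinearMap.le_opNorm _ _).trans ?_
            rw [he1, mul_one, LinearIsometryEquiv.norm_map]
            exact hW
          have h2 : ‖((√a : ℂ)⁻¹) • (ContinuousLinearMap.adjoint W) (e i : H)‖ ^ 2 ≤ a := by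
            rw [norm_smul, mul_pow, norm_inv, Complex.norm_real, Real.norm_of_nonneg hs.le,
              inv_pow, hs2]
            calc a⁻¹ * ‖(ContinuousLinearMap.adjoint W) (e i : H)‖ ^ 2 ≤ a⁻¹ * a ^ 2 := by
                  gcongr
              _ = a := by field_simp
          have h3 : ‖(√a : ℂ) • (e i : H)‖ ^ 2 = a := by
            rw [norm_smul, he1, mul_one, Complex.norm_real, Real.norm_of_nonneg hs.le, hs2]
          linarith
      _ = Module.finrank ℂ V * a := by simp
      _ ≤ r * a := by gcongr

lemma rank_sub_clm_le {S T : H →L[ℂ] H} {m n : ℕ}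
    (hS : LinearMap.rank (S : H →ₗ[ℂ] H) ≤ (m : Cardinal))
    (hT : LinearMap.rank (T : H →ₗ[ℂ] H) ≤ (n : Cardinal)) :
    LinearMap.rank ((S - T : H →L[ℂ] H) : H →ₗ[ℂ] H) ≤ ((m + n : ℕ) : Cardinal) := by
  have h : LinearMap.rank (-(T : H →ₗ[ℂ] H)) ≤ (n : Cardinal) := by
    rwa [LinearMap.rank, LinearMap.range_neg]
  have hST : ((S - T : H →L[ℂ] H) : H →ₗ[ℂ] H) = (S : H →ₗ[ℂ] H) + -(T : H →ₗ[ℂ] H) := by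
    simp [sub_eq_add_neg]
  rw [hST]
  refine (LinearMap.rank_add_le _ _).trans ((add_le_add hS h).trans ?_)
  push_cast
  exact le_rfl

/-- Dyadic splitting of an operator into a finite-rank part and a remainder of small norm. -/
lemma exists_nuclear_decomposition (D : H →L[ℂ] H) {ε : ℝ} (hε : 0 < ε) (m : ℕ) :
    ∃ D₁ D₂ : H →L[ℂ] H, D = D₁ + D₂ ∧ ‖D₂‖ ≤ sVal D (2 ^ m - 1) + ε ∧
      NuclearLE D₁ (6 * ∑ k ∈ Finset.range m, 2 ^ k * (sVal D (2 ^ k - 1) + ε)) := by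
  choose R hR hRD using fun k : ℕ => exists_rank_le_norm_sub_lt D (2 ^ k - 1) hε
  suffices h : ∀ m, NuclearLE (R m)
      (6 * ∑ k ∈ Finset.range m, 2 ^ k * (sVal D (2 ^ k - 1) + ε)) from
    ⟨R m, D - R m, by abel, (hRD m).le, h m⟩
  intro m
  induction m with
  | zero =>
    have h0 : R 0 = 0 := by
      have h := hR 0
      simp only [pow_zero, Nat.sub_self, Nat.cast_zero, nonpos_iff_eq_zero, LinearMap.rank,
        rank_eq_zero_iff] at h
      ext x
      obtain ⟨c, hc, hx⟩ := h ⟨R 0 x, LinearMap.mem_range_self (R 0 : H →ₗ[ℂ] H) x⟩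
      have hx' : c • R 0 x = 0 := congrArg Subtype.val hx
      simpa [hc] using hx'
    rw [h0]
    simpa using nuclearLE_zero
  | succ m ih =>
    have hs := sVal_nonneg D (2 ^ m - 1)
    have hnorm : ‖R (m + 1) - R m‖ ≤ 2 * (sVal D (2 ^ m - 1) + ε) := by
      have h1 : sVal D (2 ^ (m + 1) - 1) ≤ sVal D (2 ^ m - 1) :=
        sVal_antitone D (Nat.sub_le_sub_right (Nat.pow_le_pow_right (by norm_num) (by omega)) 1)
      calc ‖R (m + 1) - R m‖ = ‖(D - R m) - (D - R (m + 1))‖ := by congr 1; abel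
        _ ≤ ‖D - R m‖ + ‖D - R (m + 1)‖ := norm_sub_le _ _
        _ ≤ _ := by linarith [hRD m, hRD (m + 1)]
    have hrank := rank_sub_clm_le (hR (m + 1)) (hR m)
    have hstep := nuclearLE_of_rank_le (by positivity) hrank hnorm
    have hsum := ih.add hstep
    rw [add_sub_cancel] at hsum
    refine hsum.mono ?_
    rw [Finset.sum_range_succ, mul_add 6]
    refine add_le_add le_rfl ?_
    have hc : ((2 ^ (m + 1) - 1 + (2 ^ m - 1) : ℕ) : ℝ) ≤ 3 * 2 ^ m := by
      have : (2 ^ (m + 1) - 1 + (2 ^ m - 1) : ℕ) ≤ 3 * 2 ^ m := by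
        rw [pow_succ]; omega
      exact_mod_cast this
    calc _ ≤ 3 * 2 ^ m * (2 * (sVal D (2 ^ m - 1) + ε)) := by gcongr
      _ = _ := by ring

/-! ### Resolvents along horizontal lines -/

/-- The resolvent kernel `(x - (t + iδ))⁻¹`, where `x = Re z`. -/
def resKer (δ t : ℝ) (z : ℂ) : ℂ := (((z.re - t : ℝ) : ℂ) - δ * Complex.I)⁻¹

lemma resKer_denom_ne_zero {δ : ℝ} (hδ : δ ≠ 0) (x : ℝ) : (x : ℂ) - δ * Complex.I ≠ 0 := by
  intro h
  have := congrArg Complex.im h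
  simp [hδ] at this

lemma continuous_uncurry_resKer {δ : ℝ} (hδ : δ ≠ 0) :
    Continuous (Function.uncurry (resKer δ)) := by
  unfold resKer Function.uncurry
  exact Continuous.inv₀ (by fun_prop) fun _ => resKer_denom_ne_zero hδ _

lemma continuous_resKer {δ : ℝ} (hδ : δ ≠ 0) (t : ℝ) : Continuous (resKer δ t) :=
  (continuous_uncurry_resKer hδ).comp (Continuous.prodMk_right t)

lemma star_resKer (δ t : ℝ) (z : ℂ) : star (resKer δ t z) = resKer (-δ) t z := by
  simp [resKer, sub_eq_add_neg]

lemma star_resKer_mul_resKer (δ t : ℝ) (z : ℂ) :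
    star (resKer δ t z) * resKer δ t z = ((((z.re - t) ^ 2 + δ ^ 2)⁻¹ : ℝ) : ℂ) := by
  rw [star_resKer]
  unfold resKer
  rw [← mul_inv, Complex.ofReal_inv]
  congr 1
  push_cast
  linear_combination (-(δ : ℂ) ^ 2) * Complex.I_sq

lemma resKer_sub_resKer_neg {δ : ℝ} (hδ : δ ≠ 0) (t : ℝ) (z : ℂ) :
    resKer δ t z - resKer (-δ) t z
      = 2 * Real.pi * Complex.I * ((Real.pi⁻¹ * δ * ((z.re - t) ^ 2 + δ ^ 2)⁻¹ : ℝ) : ℂ) := by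
  have h := star_resKer_mul_resKer δ t z
  rw [star_resKer] at h
  rw [Complex.ofReal_mul, ← h]
  have h1 := resKer_denom_ne_zero hδ (z.re - t)
  have h2 := resKer_denom_ne_zero (neg_ne_zero.2 hδ) (z.re - t)
  have hpi : (Real.pi : ℂ) ≠ 0 := by exact_mod_cast Real.pi_ne_zero
  unfold resKer
  push_cast [neg_mul, sub_neg_eq_add] at h1 h2 ⊢
  field_simp
  ring

lemma inv_sq_add_sq_le {δ R x : ℝ} (hδ : δ ≠ 0) (hx : |x| ≤ R) (t : ℝ) :
    ((x - t) ^ 2 + δ ^ 2)⁻¹ ≤ (2 + (1 + 2 * R ^ 2) / δ ^ 2) * (1 + t ^ 2)⁻¹ := by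
  have hδ2 : 0 < δ ^ 2 := by positivity
  have hx2 : x ^ 2 ≤ R ^ 2 := sq_le_sq' (abs_le.1 hx).1 (abs_le.1 hx).2
  rw [← div_eq_mul_inv, le_div_iff₀ (by positivity), inv_mul_le_iff₀ (by positivity)]
  have h : (1 + 2 * R ^ 2) ≤ ((x - t) ^ 2 + δ ^ 2) * ((1 + 2 * R ^ 2) / δ ^ 2) := by
    rw [mul_div_assoc', le_div_iff₀ hδ2]
    nlinarith [sq_nonneg (x - t), sq_nonneg R, mul_nonneg (sq_nonneg (x - t)) (sq_nonneg R)]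
  nlinarith [sq_nonneg (2 * x - t)]

lemma integral_inv_sub_sq_add_sq {δ : ℝ} (hδ : δ ≠ 0) (x : ℝ) :
    ∫ t : ℝ, ((x - t) ^ 2 + δ ^ 2)⁻¹ = Real.pi / |δ| := by
  have h1 : ∀ t : ℝ, ((x - t) ^ 2 + δ ^ 2)⁻¹
      = (δ ^ 2)⁻¹ * (fun s : ℝ => (1 + (s / δ) ^ 2)⁻¹) (t - x) := by
    intro t
    simp only
    rw [← mul_inv]
    congr 1
    field_simp
    ring
  simp_rw [h1]
  rw [integral_const_mul,
    integral_sub_right_eq_self (fun s : ℝ => (1 + (s / δ) ^ 2)⁻¹) x,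
    Measure.integral_comp_div (fun s : ℝ => (1 + s ^ 2)⁻¹) δ, integral_univ_inv_one_add_sq,
    smul_eq_mul, ← sq_abs]
  have : |δ| ≠ 0 := abs_ne_zero.2 hδ
  field_simp

lemma exists_abs_re_le_of_mem_spectrum (A : H →L[ℂ] H) :
    ∃ R : ℝ, ∀ z ∈ spectrum ℂ A, |z.re| ≤ R := by
  obtain ⟨R, hR⟩ := (spectrum.isCompact (𝕜 := ℂ) A).isBounded.exists_norm_le
  exact ⟨R, fun z hz => (Complex.abs_re_le_norm z).trans (hR z hz)⟩

/-- The resolvent of `A` at `t + iδ`. -/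
def opRes (δ t : ℝ) (A : H →L[ℂ] H) : H →L[ℂ] H := cfc (resKer δ t) A

lemma adjoint_opRes (δ t : ℝ) (A : H →L[ℂ] H) :
    ContinuousLinearMap.adjoint (opRes δ t A) = opRes (-δ) t A := by
  rw [← ContinuousLinearMap.star_eq_adjoint, opRes, ← cfc_star]
  simp only [star_resKer]
  rfl

lemma cfc_resKer_denom {A : H →L[ℂ] H} (hA : IsSelfAdjoint A) (δ t : ℝ) :
    cfc (fun z : ℂ => (((z.re - t : ℝ) : ℂ) - δ * Complex.I)) A
      = A - algebraMap ℂ (H →L[ℂ] H) (t + δ * Complex.I) := by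
  have hn : IsStarNormal A := hA.isStarNormal
  have h : Set.EqOn (fun z : ℂ => (((z.re - t : ℝ) : ℂ) - δ * Complex.I))
      (fun z : ℂ => z - (t + δ * Complex.I)) (spectrum ℂ A) := by
    intro z hz
    have := hA.mem_spectrum_eq_re hz
    simp only
    conv_rhs => rw [this]
    push_cast
    ring
  rw [cfc_congr h, cfc_sub _ _ A, cfc_id' ℂ A, cfc_const _ A]

lemma opRes_mul {A : H →L[ℂ] H} (hA : IsSelfAdjoint A) {δ : ℝ} (hδ : δ ≠ 0) (t : ℝ) :
    opRes δ t A * (A - algebraMap ℂ (H →L[ℂ] H) (t + δ * Complex.I)) = 1 := by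
  have hn : IsStarNormal A := hA.isStarNormal
  rw [← cfc_resKer_denom hA, opRes, ← cfc_mul _ _ A (continuous_resKer hδ t).continuousOn
    (by fun_prop), ← cfc_one ℂ A]
  congr 1
  ext z
  exact inv_mul_cancel₀ (resKer_denom_ne_zero hδ _)

lemma mul_opRes {A : H →L[ℂ] H} (hA : IsSelfAdjoint A) {δ : ℝ} (hδ : δ ≠ 0) (t : ℝ) :
    (A - algebraMap ℂ (H →L[ℂ] H) (t + δ * Complex.I)) * opRes δ t A = 1 := by
  have hn : IsStarNormal A := hA.isStarNormal
  rw [← cfc_resKer_denom hA, opRes, ← cfc_mul _ _ A (by fun_prop)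
    (continuous_resKer hδ t).continuousOn, ← cfc_one ℂ A]
  congr 1
  ext z
  exact mul_inv_cancel₀ (resKer_denom_ne_zero hδ _)

/-- The second resolvent identity. -/
lemma opRes_sub_opRes {A B : H →L[ℂ] H} (hA : IsSelfAdjoint A) (hB : IsSelfAdjoint B) {δ : ℝ}
    (hδ : δ ≠ 0) (t : ℝ) :
    opRes δ t A - opRes δ t B = -(opRes δ t A * (A - B) * opRes δ t B) := by
  set w := algebraMap ℂ (H →L[ℂ] H) (t + δ * Complex.I)
  have h1 := opRes_mul hA hδ t
  have h2 := mul_opRes hB hδ t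
  calc opRes δ t A - opRes δ t B
      = opRes δ t A * ((B - w) * opRes δ t B) - (opRes δ t A * (A - w)) * opRes δ t B := by
        rw [h1, h2, mul_one, one_mul]
    _ = _ := by noncomm_ring

lemma norm_opRes_apply_sq {A : H →L[ℂ] H} (hA : IsSelfAdjoint A) {δ : ℝ} (hδ : δ ≠ 0) (t : ℝ)
    (x : H) : ‖opRes δ t A x‖ ^ 2
      = (⟪x, cfc (fun z : ℂ => ((((z.re - t) ^ 2 + δ ^ 2)⁻¹ : ℝ) : ℂ)) A x⟫_ℂ).re := by
  have hn : IsStarNormal A := hA.isStarNormal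
  have h : cfc (fun z : ℂ => ((((z.re - t) ^ 2 + δ ^ 2)⁻¹ : ℝ) : ℂ)) A
      = ContinuousLinearMap.adjoint (opRes δ t A) * opRes δ t A := by
    simp_rw [← star_resKer_mul_resKer]
    rw [cfc_mul _ _ A (continuous_resKer hδ t).star.continuousOn
      (continuous_resKer hδ t).continuousOn, cfc_star, ContinuousLinearMap.star_eq_adjoint]
    rfl
  rw [h, mul_apply_eq_comp, ContinuousLinearMap.adjoint_inner_right,
    inner_self_eq_norm_sq_to_K]
  norm_cast

lemma continuous_uncurry_inv_sub_sq_add_sq {δ : ℝ} (hδ : δ ≠ 0) :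
    Continuous (Function.uncurry fun (t : ℝ) (z : ℂ) =>
      ((((z.re - t) ^ 2 + δ ^ 2)⁻¹ : ℝ) : ℂ)) := by
  refine Complex.continuous_ofReal.comp (Continuous.inv₀ (by fun_prop) fun _ => ?_)
  positivity

lemma integrable_cfc_inv_sub_sq_add_sq {A : H →L[ℂ] H} (hA : IsSelfAdjoint A) {δ : ℝ}
    (hδ : δ ≠ 0) :
    Integrable (fun t : ℝ => cfc (fun z : ℂ => ((((z.re - t) ^ 2 + δ ^ 2)⁻¹ : ℝ) : ℂ)) A) ∧
    ∫ t : ℝ, cfc (fun z : ℂ => ((((z.re - t) ^ 2 + δ ^ 2)⁻¹ : ℝ) : ℂ)) A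
      = ((Real.pi / |δ| : ℝ) : ℂ) • (1 : H →L[ℂ] H) := by
  have hn : IsStarNormal A := hA.isStarNormal
  obtain ⟨R, hR⟩ := exists_abs_re_le_of_mem_spectrum A
  have hb : ∀ᵐ t : ℝ, ∀ z ∈ spectrum ℂ A, ‖((((z.re - t) ^ 2 + δ ^ 2)⁻¹ : ℝ) : ℂ)‖
      ≤ (2 + (1 + 2 * R ^ 2) / δ ^ 2) * (1 + t ^ 2)⁻¹ := by
    refine .of_forall fun t z hz => ?_
    rw [Complex.norm_real, Real.norm_of_nonneg (by positivity)]
    exact inv_sq_add_sq_le hδ (hR z hz) t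
  have hfin : HasFiniteIntegral
      (fun t : ℝ => (2 + (1 + 2 * R ^ 2) / δ ^ 2) * (1 + t ^ 2)⁻¹) :=
    (integrable_inv_one_add_sq.const_mul _).2
  have hc := (continuous_uncurry_inv_sub_sq_add_sq hδ).continuousOn
    (s := Set.univ ×ˢ spectrum ℂ A)
  refine ⟨integrable_cfc _ _ A hc hb hfin, ?_⟩
  rw [← cfc_integral _ _ A hc hb hfin]
  simp_rw [integral_complex_ofReal, integral_inv_sub_sq_add_sq hδ]
  rw [cfc_const _ A, Algebra.algebraMap_eq_smul_one]

lemma integrable_norm_opRes_apply_sq {A : H →L[ℂ] H} (hA : IsSelfAdjoint A) {δ : ℝ}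
    (hδ : δ ≠ 0) (x : H) : Integrable fun t : ℝ => ‖opRes δ t A x‖ ^ 2 := by
  simp_rw [norm_opRes_apply_sq hA hδ]
  exact (((integrable_cfc_inv_sub_sq_add_sq hA hδ).1.apply_continuousLinearMap
    x).const_inner (𝕜 := ℂ) x).re

lemma integral_norm_opRes_apply_sq {A : H →L[ℂ] H} (hA : IsSelfAdjoint A) {δ : ℝ}
    (hδ : δ ≠ 0) (x : H) : ∫ t : ℝ, ‖opRes δ t A x‖ ^ 2 = Real.pi / |δ| * ‖x‖ ^ 2 := by
  obtain ⟨hi, he⟩ := integrable_cfc_inv_sub_sq_add_sq hA hδ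
  simp_rw [norm_opRes_apply_sq hA hδ]
  have h := integral_re ((hi.apply_continuousLinearMap x).const_inner (𝕜 := ℂ) x)
  simp only [RCLike.re_to_complex] at h
  rw [h, integral_inner (hi.apply_continuousLinearMap x),
    ← ContinuousLinearMap.integral_apply hi, he]
  simp only [smul_apply, one_apply_eq_self, inner_smul_right, inner_self_eq_norm_sq_to_K]
  rw [Complex.re_ofReal_mul]
  norm_cast

/-! ### Smoothing by the Cauchy distribution -/

/-- The standard Cauchy distribution. -/
local notation "νC" => ProbabilityTheory.cauchyMeasure 0 1

/-- Convolution of `g` with the Cauchy distribution of scale `δ`. -/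
def cauchySmooth (δ : ℝ) (g : ℝ → ℂ) (x : ℝ) : ℂ := ∫ s, g (x - δ * s) ∂νC

lemma integral_cauchyMeasure {E : Type} [NormedAddCommGroup E] [NormedSpace ℝ E]
    (F : ℝ → E) : ∫ s, F s ∂νC = ∫ s : ℝ, (Real.pi⁻¹ * (1 + s ^ 2)⁻¹) • F s := by
  rw [ProbabilityTheory.cauchyMeasure_of_scale_ne_zero _ one_ne_zero,
    integral_withDensity_eq_integral_toReal_smul
      (ProbabilityTheory.measurable_cauchyPDF 0 1) (.of_forall fun _ => by
        simp [ProbabilityTheory.cauchyPDF])]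
  congr 1
  ext s
  rw [ProbabilityTheory.cauchyPDF_def, ENNReal.toReal_ofReal (by
    rw [ProbabilityTheory.cauchyPDFReal_def]; positivity),
    ProbabilityTheory.cauchyPDFReal_def]
  simp [add_comm]

lemma cauchySmooth_eq_integral {δ : ℝ} (hδ : 0 < δ) (g : ℝ → ℂ) (x : ℝ) :
    cauchySmooth δ g x
      = ∫ t : ℝ, g t * ((Real.pi⁻¹ * δ * ((x - t) ^ 2 + δ ^ 2)⁻¹ : ℝ) : ℂ) := by
  set F : ℝ → ℂ := fun t => g t * ((Real.pi⁻¹ * δ * ((x - t) ^ 2 + δ ^ 2)⁻¹ : ℝ) : ℂ) with hF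
  have h1 : ∫ s : ℝ, F (x - δ * s) = δ⁻¹ • ∫ t, F t := by
    rw [Measure.integral_comp_mul_left (fun u => F (x - u)) δ,
      integral_sub_left_eq_self F volume x, abs_of_pos (inv_pos.2 hδ)]
  have h2 : ∫ t, F t = δ • ∫ s : ℝ, F (x - δ * s) := by
    rw [h1, smul_smul, mul_inv_cancel₀ hδ.ne', one_smul]
  rw [h2, cauchySmooth, integral_cauchyMeasure, ← integral_smul]
  congr 1
  ext s
  rw [hF]
  simp only [sub_sub_cancel, Complex.real_smul]
  rw [show (δ * s) ^ 2 + δ ^ 2 = δ ^ 2 * (1 + s ^ 2) by ring]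
  have h3 : (1 + (s : ℂ) ^ 2) ≠ 0 := by
    exact_mod_cast (by positivity : (1 + s ^ 2 : ℝ) ≠ 0)
  have hδ' : (δ : ℂ) ≠ 0 := by exact_mod_cast hδ.ne'
  push_cast
  field_simp

lemma integrable_comp_cauchyMeasure {g : ℝ → ℂ} (hg : Continuous g) {M : ℝ}
    (hM : ∀ x, ‖g x‖ ≤ M) (δ x : ℝ) : Integrable (fun s => g (x - δ * s)) νC :=
  Integrable.of_bound (hg.comp (by fun_prop)).aestronglyMeasurable M (.of_forall fun _ => hM _)

lemma norm_cauchySmooth_le {g : ℝ → ℂ} {M : ℝ} (hM : ∀ x, ‖g x‖ ≤ M) (δ x : ℝ) :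
    ‖cauchySmooth δ g x‖ ≤ M := by
  refine (norm_integral_le_of_norm_le_const (.of_forall fun s => hM _)).trans_eq ?_
  simp

lemma continuous_cauchySmooth {g : ℝ → ℂ} (hg : Continuous g) {M : ℝ}
    (hM : ∀ x, ‖g x‖ ≤ M) (δ : ℝ) : Continuous (cauchySmooth δ g) :=
  continuous_of_dominated (fun _ => (hg.comp (by fun_prop)).aestronglyMeasurable)
    (fun _ => .of_forall fun _ => hM _) (integrable_const M)
    (.of_forall fun _ => hg.comp (by fun_prop))

lemma cauchySmooth_sub {g h : ℝ → ℂ} (hg : Continuous g) (hh : Continuous h) {M N : ℝ}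
    (hM : ∀ x, ‖g x‖ ≤ M) (hN : ∀ x, ‖h x‖ ≤ N) (δ : ℝ) :
    cauchySmooth δ (g - h) = cauchySmooth δ g - cauchySmooth δ h := by
  ext x
  exact integral_sub (integrable_comp_cauchyMeasure hg hM δ x)
    (integrable_comp_cauchyMeasure hh hN δ x)

lemma cauchySmooth_comm {g : ℝ → ℂ} (hg : Continuous g) {M : ℝ}
    (hM : ∀ x, ‖g x‖ ≤ M) (δ η : ℝ) :
    cauchySmooth δ (cauchySmooth η g) = cauchySmooth η (cauchySmooth δ g) := by
  ext x
  unfold cauchySmooth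
  rw [integral_integral_swap]
  · congr 1
    ext s
    congr 1
    ext r
    congr 1
    ring
  · exact Integrable.of_bound (Continuous.aestronglyMeasurable (hg.comp (by fun_prop))) M
      (.of_forall fun _ => hM _)

lemma HoelderWith.continuous {C α : ℝ} (hα : 0 < α) {f : ℝ → ℂ} (hf : HoelderWith C α f) :
    Continuous f := by
  rw [continuous_iff_continuousAt]
  intro x
  rw [ContinuousAt, tendsto_iff_norm_sub_tendsto_zero]
  have h : Filter.Tendsto (fun y => C * |y - x| ^ α) (nhds x) (nhds (C * |x - x| ^ α)) := by
    refine Continuous.tendsto ?_ x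
    exact continuous_const.mul
      ((continuous_abs.comp (by fun_prop)).rpow_const fun _ => Or.inr hα.le)
  rw [sub_self, abs_zero, Real.zero_rpow hα.ne', mul_zero] at h
  exact squeeze_zero (fun _ => norm_nonneg _) (fun y => hf y x) h

lemma hoelderWith_cauchySmooth {C α : ℝ} {f : ℝ → ℂ} (hf : HoelderWith C α f)
    (hfc : Continuous f) {M : ℝ} (hM : ∀ x, ‖f x‖ ≤ M) (δ : ℝ) :
    HoelderWith C α (cauchySmooth δ f) := by
  intro x y
  unfold cauchySmooth
  rw [← integral_sub (integrable_comp_cauchyMeasure hfc hM δ x)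
    (integrable_comp_cauchyMeasure hfc hM δ y)]
  refine (norm_integral_le_of_norm_le_const (C := C * |x - y| ^ α)
    (.of_forall fun s => ?_)).trans_eq (by simp)
  simpa using hf (x - δ * s) (y - δ * s)

/-- The absolute moment of order `α` of the Cauchy distribution. -/
def cauchyMoment (α : ℝ) : ℝ := ∫ s, |s| ^ α ∂νC

lemma cauchyMoment_nonneg (α : ℝ) : 0 ≤ cauchyMoment α :=
  integral_nonneg fun _ => by positivity

lemma integrable_abs_rpow_cauchyMeasure {α : ℝ} (hα0 : 0 < α) (hα1 : α < 1) :
    Integrable (fun s : ℝ => |s| ^ α) νC := by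
  rw [ProbabilityTheory.cauchyMeasure_of_scale_ne_zero _ one_ne_zero,
    integrable_withDensity_iff (ProbabilityTheory.measurable_cauchyPDF 0 1) (.of_forall fun _ => by
        simp [ProbabilityTheory.cauchyPDF])]
  have hi : Integrable (fun s : ℝ => Real.pi⁻¹ * ((1 : ℝ) + ‖s‖ ^ 2) ^ (-(2 - α) / 2)) :=
    (integrable_rpow_neg_one_add_norm_sq (by simp; linarith)).const_mul _
  refine hi.mono' (by
    refine AEStronglyMeasurable.mul ?_ ?_
    · exact (continuous_abs.rpow_const fun _ => Or.inr hα0.le).aestronglyMeasurable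
    · exact (ProbabilityTheory.measurable_cauchyPDF 0 1).ennreal_toReal.aestronglyMeasurable)
    (.of_forall fun s => ?_)
  rw [ProbabilityTheory.cauchyPDF_def, ENNReal.toReal_ofReal (by
    rw [ProbabilityTheory.cauchyPDFReal_def]; positivity),
    ProbabilityTheory.cauchyPDFReal_def, Real.norm_of_nonneg (by positivity)]
  have h1 : |s| ^ α ≤ (1 + s ^ 2) ^ (α / 2) := by
    calc |s| ^ α = (s ^ 2) ^ (α / 2) := by
          rw [← sq_abs, ← Real.rpow_natCast, ← Real.rpow_mul (abs_nonneg s)]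
          congr 1; push_cast; ring
      _ ≤ _ := Real.rpow_le_rpow (by positivity) (by linarith) (by positivity)
  have h2 : (1 + s ^ 2) ^ (-(2 - α) / 2) = (1 + s ^ 2) ^ (α / 2) * (1 + s ^ 2)⁻¹ := by
    rw [← Real.rpow_neg_one, ← Real.rpow_add (by positivity)]
    congr 1; ring
  simp only [NNReal.coe_one, mul_one, sub_zero, one_pow, Real.norm_eq_abs, sq_abs]
  rw [h2, add_comm (s ^ 2)]
  calc |s| ^ α * (Real.pi⁻¹ * (1 + s ^ 2)⁻¹)
      ≤ (1 + s ^ 2) ^ (α / 2) * (Real.pi⁻¹ * (1 + s ^ 2)⁻¹) := by gcongr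
    _ = _ := by ring

lemma HoelderWith.norm_sub_cauchySmooth_le {C α : ℝ} (hα0 : 0 < α) (hα1 : α < 1) {f : ℝ → ℂ}
    (hf : HoelderWith C α f) {M : ℝ} (hM : ∀ x, ‖f x‖ ≤ M) {δ : ℝ} (hδ : 0 ≤ δ) (x : ℝ) :
    ‖f x - cauchySmooth δ f x‖ ≤ C * cauchyMoment α * δ ^ α := by
  have h : f x - cauchySmooth δ f x = ∫ s, (f x - f (x - δ * s)) ∂νC := by
    rw [integral_sub (integrable_const _)
      (integrable_comp_cauchyMeasure (hf.continuous hα0) hM δ x)]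
    simp [cauchySmooth]
  rw [h]
  refine (norm_integral_le_of_norm_le
    ((integrable_abs_rpow_cauchyMeasure hα0 hα1).const_mul (C * δ ^ α))
    (.of_forall fun s => ?_)).trans_eq ?_
  · refine (hf _ _).trans_eq ?_
    rw [sub_sub_cancel, abs_mul, abs_of_nonneg hδ, Real.mul_rpow hδ (abs_nonneg s)]
    ring
  · rw [integral_const_mul, cauchyMoment]
    ring

/-! ### Ky Fan estimate for smoothed functions -/

lemma opFun_cauchySmooth {A : H →L[ℂ] H} (hA : IsSelfAdjoint A) {δ : ℝ} (hδ : 0 < δ)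
    {g : ℝ → ℂ} (hg : Continuous g) {M : ℝ} (hM : ∀ x, ‖g x‖ ≤ M) :
    Integrable (fun t : ℝ => (g t * (2 * Real.pi * Complex.I)⁻¹) •
      (opRes δ t A - opRes (-δ) t A)) ∧
    opFun (cauchySmooth δ g) A = ∫ t : ℝ, (g t * (2 * Real.pi * Complex.I)⁻¹) •
      (opRes δ t A - opRes (-δ) t A) := by
  have hn : IsStarNormal A := hA.isStarNormal
  have hM0 : 0 ≤ M := (norm_nonneg _).trans (hM 0)
  obtain ⟨R, hR⟩ := exists_abs_re_le_of_mem_spectrum A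
  set k : ℝ → ℂ → ℂ := fun t z =>
    g t * ((Real.pi⁻¹ * δ * ((z.re - t) ^ 2 + δ ^ 2)⁻¹ : ℝ) : ℂ) with hk
  have hkc : ∀ t, cfc (k t) A = (g t * (2 * Real.pi * Complex.I)⁻¹) •
      (opRes δ t A - opRes (-δ) t A) := by
    intro t
    have h1 := continuous_resKer hδ.ne' t
    have h2 := continuous_resKer (neg_ne_zero.2 hδ.ne') t
    rw [opRes, opRes, ← cfc_sub _ _ A h1.continuousOn h2.continuousOn,
      ← cfc_smul _ (fun x => resKer δ t x - resKer (-δ) t x) A (h1.sub h2).continuousOn]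
    congr 1
    ext z
    rw [resKer_sub_resKer_neg hδ.ne', smul_eq_mul, hk]
    have hpi : (Real.pi : ℂ) ≠ 0 := by exact_mod_cast Real.pi_ne_zero
    have hI := Complex.I_ne_zero
    field_simp
  have hb : ∀ᵐ t : ℝ, ∀ z ∈ spectrum ℂ A, ‖k t z‖
      ≤ M * (Real.pi⁻¹ * δ * (2 + (1 + 2 * R ^ 2) / δ ^ 2)) * (1 + t ^ 2)⁻¹ := by
    refine .of_forall fun t z hz => ?_
    rw [hk, norm_mul, Complex.norm_real, Real.norm_of_nonneg (by positivity)]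
    calc _ ≤ M * (Real.pi⁻¹ * δ * ((2 + (1 + 2 * R ^ 2) / δ ^ 2) * (1 + t ^ 2)⁻¹)) := by
          gcongr
          · exact hM t
          · exact inv_sq_add_sq_le hδ.ne' (hR z hz) t
      _ = _ := by ring
  have hfin : HasFiniteIntegral (fun t : ℝ =>
      M * (Real.pi⁻¹ * δ * (2 + (1 + 2 * R ^ 2) / δ ^ 2)) * (1 + t ^ 2)⁻¹) :=
    (integrable_inv_one_add_sq.const_mul _).2
  have hc : ContinuousOn (Function.uncurry k) (Set.univ ×ˢ spectrum ℂ A) := by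
    refine Continuous.continuousOn ((hg.comp continuous_fst).mul ?_)
    refine Complex.continuous_ofReal.comp
      (continuous_const.mul (Continuous.inv₀ (by fun_prop) fun _ => ?_))
    positivity
  simp_rw [← hkc]
  refine ⟨integrable_cfc _ _ A hc hb hfin, ?_⟩
  rw [← cfc_integral _ _ A hc hb hfin, opFun]
  simp_rw [cauchySmooth_eq_integral hδ g]
  rfl

lemma sum_norm_inner_rankOne_le {n : ℕ} {x y : Fin n → H} (hx : Orthonormal ℂ x)
    (hy : Orthonormal ℂ y) (a b : H) :
    ∑ k, ‖⟪y k, a⟫_ℂ‖ * ‖⟪b, x k⟫_ℂ‖ ≤ (‖a‖ ^ 2 + ‖b‖ ^ 2) / 2 := by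
  have h1 := hy.sum_inner_products_le (s := Finset.univ) a
  have h2 := hx.sum_inner_products_le (s := Finset.univ) b
  calc ∑ k, ‖⟪y k, a⟫_ℂ‖ * ‖⟪b, x k⟫_ℂ‖
      ≤ ∑ k, (‖⟪y k, a⟫_ℂ‖ ^ 2 + ‖⟪x k, b⟫_ℂ‖ ^ 2) / 2 := by
        refine Finset.sum_le_sum fun k _ => ?_
        rw [norm_inner_symm b]
        linarith [two_mul_le_add_sq ‖⟪y k, a⟫_ℂ‖ ‖⟪x k, b⟫_ℂ‖]
    _ = (∑ k, ‖⟪y k, a⟫_ℂ‖ ^ 2 + ∑ k, ‖⟪x k, b⟫_ℂ‖ ^ 2) / 2 := by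
        rw [← Finset.sum_add_distrib, Finset.sum_div]
    _ ≤ _ := by linarith

/-- Domination of the Ky Fan functional of a difference of resolvents by a function with
explicit integral. -/
lemma exists_dominating_opRes_sub {A B : H →L[ℂ] H} (hA : IsSelfAdjoint A)
    (hB : IsSelfAdjoint B) {D₁ D₂ : H →L[ℂ] H} {c : ℝ} (hD : A - B = D₁ + D₂)
    (hD₁ : NuclearLE D₁ c) {n : ℕ} {x y : Fin n → H} (hx : Orthonormal ℂ x)
    (hy : Orthonormal ℂ y) {δ : ℝ} (hδ : δ ≠ 0) :
    ∃ G : ℝ → ℝ, Integrable G ∧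
      (∀ t, ∑ k, ‖⟪y k, (opRes δ t A - opRes δ t B) (x k)⟫_ℂ‖ ≤ G t) ∧
      ∫ t, G t ≤ Real.pi / |δ| * (c + n * ‖D₂‖) := by
  obtain ⟨ι, _, u, v, hD₁, hc⟩ := hD₁
  have hIA := fun w : H => integrable_norm_opRes_apply_sq hA hδ w
  have hIB := fun w : H => integrable_norm_opRes_apply_sq hB hδ w
  have hIA' := fun w : H => integrable_norm_opRes_apply_sq hA (neg_ne_zero.2 hδ) w
  have hIB' := fun w : H => integrable_norm_opRes_apply_sq hB (neg_ne_zero.2 hδ) w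
  have hI1 : ∀ i ∈ (Finset.univ : Finset ι), Integrable fun t : ℝ =>
      (‖opRes δ t A (u i)‖ ^ 2 + ‖opRes (-δ) t B (v i)‖ ^ 2) / 2 :=
    fun i _ => ((hIA _).add (hIB' _)).div_const 2
  have hI2 : ∀ k ∈ (Finset.univ : Finset (Fin n)), Integrable fun t : ℝ =>
      ‖D₂‖ * ((‖opRes (-δ) t A (y k)‖ ^ 2 + ‖opRes δ t B (x k)‖ ^ 2) / 2) :=
    fun k _ => (((hIA' _).add (hIB _)).div_const 2).const_mul _
  refine ⟨fun t => ∑ i, (‖opRes δ t A (u i)‖ ^ 2 + ‖opRes (-δ) t B (v i)‖ ^ 2) / 2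
    + ∑ k, ‖D₂‖ * ((‖opRes (-δ) t A (y k)‖ ^ 2 + ‖opRes δ t B (x k)‖ ^ 2) / 2),
    (integrable_finsetSum _ hI1).add (integrable_finsetSum _ hI2), fun t => ?_, ?_⟩
  · have hk : ∀ k, ‖⟪y k, (opRes δ t A - opRes δ t B) (x k)⟫_ℂ‖
        ≤ ∑ i, ‖⟪y k, opRes δ t A (u i)⟫_ℂ‖ * ‖⟪opRes (-δ) t B (v i), x k⟫_ℂ‖
          + ‖D₂‖ * ((‖opRes (-δ) t A (y k)‖ ^ 2 + ‖opRes δ t B (x k)‖ ^ 2) / 2) := by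
      intro k
      have hadj : ∀ w, ⟪y k, opRes δ t A w⟫_ℂ = ⟪opRes (-δ) t A (y k), w⟫_ℂ := fun w => by
        rw [← adjoint_opRes, ContinuousLinearMap.adjoint_inner_left]
      rw [opRes_sub_opRes hA hB hδ, hD, neg_apply, inner_neg_right, norm_neg, mul_apply_eq_comp,
        mul_apply_eq_comp, add_apply, map_add, inner_add_right]
      refine (norm_add_le _ _).trans (add_le_add ?_ ?_)
      · rw [hD₁, map_sum, inner_sum]
        refine (norm_sum_le _ _).trans (Finset.sum_le_sum fun i _ => ?_)
        rw [map_smul, inner_smul_right, norm_mul, mul_comm, ← adjoint_opRes,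
          ContinuousLinearMap.adjoint_inner_left]
      · rw [hadj]
        refine (norm_inner_le_norm _ _).trans ?_
        have h1 := D₂.le_opNorm (opRes δ t B (x k))
        have h2 := two_mul_le_add_sq ‖opRes (-δ) t A (y k)‖ ‖opRes δ t B (x k)‖
        calc ‖opRes (-δ) t A (y k)‖ * ‖D₂ (opRes δ t B (x k))‖
            ≤ ‖opRes (-δ) t A (y k)‖ * (‖D₂‖ * ‖opRes δ t B (x k)‖) := by gcongr
          _ = ‖D₂‖ * (‖opRes (-δ) t A (y k)‖ * ‖opRes δ t B (x k)‖) := by ring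
          _ ≤ _ := by gcongr; linarith
    refine (Finset.sum_le_sum fun k _ => hk k).trans ?_
    rw [Finset.sum_add_distrib, Finset.sum_comm]
    exact add_le_add (Finset.sum_le_sum fun i _ => sum_norm_inner_rankOne_le hx hy _ _) le_rfl
  · rw [integral_add (integrable_finsetSum _ hI1) (integrable_finsetSum _ hI2),
      integral_finsetSum _ hI1, integral_finsetSum _ hI2]
    have e1 : ∀ i, ∫ t : ℝ, (‖opRes δ t A (u i)‖ ^ 2 + ‖opRes (-δ) t B (v i)‖ ^ 2) / 2
        = Real.pi / |δ| * ((‖u i‖ ^ 2 + ‖v i‖ ^ 2) / 2) := by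
      intro i
      rw [integral_div, integral_add (hIA _) (hIB' _), integral_norm_opRes_apply_sq hA hδ,
        integral_norm_opRes_apply_sq hB (neg_ne_zero.2 hδ), abs_neg]
      ring
    have e2 : ∀ k, ∫ t : ℝ,
        ‖D₂‖ * ((‖opRes (-δ) t A (y k)‖ ^ 2 + ‖opRes δ t B (x k)‖ ^ 2) / 2)
        = Real.pi / |δ| * ‖D₂‖ := by
      intro k
      rw [integral_const_mul, integral_div, integral_add (hIA' _) (hIB _),
        integral_norm_opRes_apply_sq hA (neg_ne_zero.2 hδ),
        integral_norm_opRes_apply_sq hB hδ, abs_neg, hx.1 k, hy.1 k]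
      ring
    simp_rw [e1, e2]
    rw [← Finset.mul_sum, Finset.sum_const, Finset.card_univ, Fintype.card_fin, nsmul_eq_mul,
      mul_left_comm, ← mul_add]
    gcongr

lemma kyFanLE_cauchySmooth {A B : H →L[ℂ] H} (hA : IsSelfAdjoint A) (hB : IsSelfAdjoint B)
    {D₁ D₂ : H →L[ℂ] H} {c : ℝ} (hD : A - B = D₁ + D₂) (hD₁ : NuclearLE D₁ c)
    {δ : ℝ} (hδ : 0 < δ) {g : ℝ → ℂ} (hg : Continuous g) {M : ℝ} (hM : ∀ x, ‖g x‖ ≤ M) (n : ℕ) :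
    KyFanLE n (opFun (cauchySmooth δ g) A - opFun (cauchySmooth δ g) B)
      (M / δ * (c + n * ‖D₂‖)) := by
  intro x y hx hy
  have hM0 : 0 ≤ M := (norm_nonneg _).trans (hM 0)
  obtain ⟨hiA, heA⟩ := opFun_cauchySmooth hA hδ hg hM
  obtain ⟨hiB, heB⟩ := opFun_cauchySmooth hB hδ hg hM
  obtain ⟨G, hG, hGle, hGint⟩ := exists_dominating_opRes_sub hA hB hD hD₁ hx hy hδ.ne'
  obtain ⟨G', hG', hGle', hGint'⟩ :=
    exists_dominating_opRes_sub hA hB hD hD₁ hx hy (neg_ne_zero.2 hδ.ne')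
  rw [abs_neg] at hGint'
  rw [abs_of_pos hδ] at hGint hGint'
  rw [heA, heB, ← integral_sub hiA hiB]
  set Φ : ℝ → H →L[ℂ] H := fun t =>
    (g t * (2 * Real.pi * Complex.I)⁻¹) • (opRes δ t A - opRes (-δ) t A)
      - (g t * (2 * Real.pi * Complex.I)⁻¹) • (opRes δ t B - opRes (-δ) t B) with hΦ
  have hiΦ : Integrable Φ := hiA.sub hiB
  have hiF : ∀ k ∈ (Finset.univ : Finset (Fin n)),
      Integrable fun t => ⟪y k, Φ t (x k)⟫_ℂ :=
    fun k _ => (hiΦ.apply_continuousLinearMap (x k)).const_inner (y k)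
  have hΦle : ∀ t, ∑ k, ‖⟪y k, Φ t (x k)⟫_ℂ‖ ≤ M * (2 * Real.pi)⁻¹ * (G t + G' t) := by
    intro t
    have hk : ∀ k, ‖⟪y k, Φ t (x k)⟫_ℂ‖ ≤ M * (2 * Real.pi)⁻¹ *
        (‖⟪y k, (opRes δ t A - opRes δ t B) (x k)⟫_ℂ‖
          + ‖⟪y k, (opRes (-δ) t A - opRes (-δ) t B) (x k)⟫_ℂ‖) := by
      intro k
      have h1 : Φ t = (g t * (2 * Real.pi * Complex.I)⁻¹) •
          ((opRes δ t A - opRes δ t B) - (opRes (-δ) t A - opRes (-δ) t B)) := by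
        simp only [hΦ]
        rw [← smul_sub]
        congr 1
        abel
      have h2 : ‖g t * (2 * Real.pi * Complex.I)⁻¹‖ ≤ M * (2 * Real.pi)⁻¹ := by
        rw [norm_mul]
        gcongr
        · exact hM t
        · simp [abs_of_pos Real.pi_pos]
      rw [h1, smul_apply, sub_apply, inner_smul_right, norm_mul, inner_sub_right]
      gcongr
      exact norm_sub_le _ _
    refine (Finset.sum_le_sum fun k _ => hk k).trans ?_
    rw [← Finset.mul_sum, Finset.sum_add_distrib]
    gcongr
    · exact hGle t
    · exact hGle' t
  calc ∑ k, ‖⟪y k, (∫ t, Φ t) (x k)⟫_ℂ‖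
      = ∑ k, ‖∫ t, ⟪y k, Φ t (x k)⟫_ℂ‖ := by
        refine Finset.sum_congr rfl fun k _ => ?_
        rw [ContinuousLinearMap.integral_apply hiΦ,
          integral_inner (hiΦ.apply_continuousLinearMap (x k))]
    _ ≤ ∑ k, ∫ t, ‖⟪y k, Φ t (x k)⟫_ℂ‖ :=
        Finset.sum_le_sum fun k _ => norm_integral_le_integral_norm _
    _ = ∫ t, ∑ k, ‖⟪y k, Φ t (x k)⟫_ℂ‖ :=
        (integral_finsetSum _ fun k hk => (hiF k hk).norm).symm
    _ ≤ ∫ t, M * (2 * Real.pi)⁻¹ * (G t + G' t) :=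
        integral_mono (integrable_finsetSum _ fun k hk => (hiF k hk).norm)
          ((hG.add hG').const_mul _) hΦle
    _ = M * (2 * Real.pi)⁻¹ * ((∫ t, G t) + ∫ t, G' t) := by
        rw [integral_const_mul, integral_add hG hG']
    _ ≤ M * (2 * Real.pi)⁻¹ * (Real.pi / δ * (c + n * ‖D₂‖) + Real.pi / δ * (c + n * ‖D₂‖)) := by
        gcongr
    _ = M / δ * (c + n * ‖D₂‖) := by
        have := Real.pi_ne_zero
        field_simp
        ring

/-! ### Ky Fan estimate for Hölder functions -/

lemma opFun_sub_fun {f g : ℝ → ℂ} (hf : Continuous f) (hg : Continuous g) (A : H →L[ℂ] H) :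
    opFun (f - g) A = opFun f A - opFun g A :=
  cfc_sub (fun z : ℂ => f z.re) (fun z : ℂ => g z.re) A
    (hf.comp Complex.continuous_re).continuousOn (hg.comp Complex.continuous_re).continuousOn

lemma norm_opFun_le {f : ℝ → ℂ} {M : ℝ} (hM : ∀ x, ‖f x‖ ≤ M) (A : H →L[ℂ] H) :
    ‖opFun f A‖ ≤ M :=
  norm_cfc_le ((norm_nonneg _).trans (hM 0)) fun _ _ => hM _

lemma KyFanLE.of_tendsto {n : ℕ} {T : H →L[ℂ] H} {c : ℕ → ℝ} {a : ℝ}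
    (hT : ∀ N, KyFanLE n T (c N)) (hc : Filter.Tendsto c Filter.atTop (nhds a)) : KyFanLE n T a :=
  fun x y hx hy => ge_of_tendsto' hc fun N => hT N x y hx hy

section

variable {A B D₁ D₂ : H →L[ℂ] H} {c C α M δ : ℝ} {f : ℝ → ℂ}

lemma kyFanLE_cauchySmooth_of_hoelderWith_aux (hA : IsSelfAdjoint A) (hB : IsSelfAdjoint B)
    (hD : A - B = D₁ + D₂) (hD₁ : NuclearLE D₁ c) (hc : 0 ≤ c) (hα0 : 0 < α) (hα1 : α < 1)
    (hC : 0 ≤ C) (n N : ℕ) (hδ : 0 < δ) (hf : HoelderWith C α f) (hM : ∀ x, ‖f x‖ ≤ M) :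
    KyFanLE n (opFun (cauchySmooth δ f) A - opFun (cauchySmooth δ f) B)
      ((C * cauchyMoment α * 2 ^ α * δ ^ (α - 1) / (1 - 2 ^ (α - 1)) + M / δ * (1 / 2) ^ N)
        * (c + n * ‖D₂‖)) := by
  have hq : (2 : ℝ) ^ (α - 1) < 1 := Real.rpow_lt_one_of_one_lt_of_neg one_lt_two (by linarith)
  have hmom := cauchyMoment_nonneg α
  induction N generalizing f δ with
  | zero =>
    refine (kyFanLE_cauchySmooth hA hB hD hD₁ hδ (hf.continuous hα0) hM n).mono ?_
    refine mul_le_mul_of_nonneg_right ?_ (by positivity)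
    have : 0 ≤ C * cauchyMoment α * 2 ^ α * δ ^ (α - 1) / (1 - 2 ^ (α - 1)) :=
      div_nonneg (by positivity) (by linarith)
    rw [pow_zero, mul_one]
    linarith
  | succ N ih =>
    have hfc := hf.continuous hα0
    have hsc := continuous_cauchySmooth hfc hM (2 * δ)
    have hsM := norm_cauchySmooth_le hM (2 * δ)
    have hcc := continuous_cauchySmooth hfc hM δ
    have hcM := norm_cauchySmooth_le hM δ
    have hsplit : cauchySmooth δ (f - cauchySmooth (2 * δ) f)
        = cauchySmooth δ f - cauchySmooth (2 * δ) (cauchySmooth δ f) := by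
      rw [cauchySmooth_sub hfc hsc hM hsM, cauchySmooth_comm hfc hM]
    have h1 := kyFanLE_cauchySmooth hA hB hD hD₁ hδ (hfc.sub hsc)
      (fun x => hf.norm_sub_cauchySmooth_le hα0 hα1 hM (by positivity : (0 : ℝ) ≤ 2 * δ) x) n
    have h2 := ih (by positivity : (0 : ℝ) < 2 * δ)
      (hoelderWith_cauchySmooth hf hfc hM δ) hcM
    have hs2 := continuous_cauchySmooth hcc hcM (2 * δ)
    change KyFanLE n (opFun (cauchySmooth δ (f - cauchySmooth (2 * δ) f)) A
      - opFun (cauchySmooth δ (f - cauchySmooth (2 * δ) f)) B) _ at h1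
    rw [hsplit, opFun_sub_fun hcc hs2, opFun_sub_fun hcc hs2] at h1
    convert h1.add h2 using 1
    · abel
    · have e1 : (2 * δ) ^ α = 2 ^ α * (δ ^ (α - 1) * δ) := by
        rw [Real.mul_rpow two_pos.le hδ.le, Real.rpow_sub_one hδ.ne', div_mul_cancel₀ _ hδ.ne']
      have e2 : (2 * δ) ^ (α - 1) = 2 ^ (α - 1) * δ ^ (α - 1) :=
        Real.mul_rpow two_pos.le hδ.le
      have hq' : (1 : ℝ) - 2 ^ (α - 1) ≠ 0 := by linarith
      rw [e1, e2, pow_succ]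
      generalize (2 : ℝ) ^ (α - 1) = q at *
      field_simp
      ring

lemma kyFanLE_cauchySmooth_of_hoelderWith (hA : IsSelfAdjoint A) (hB : IsSelfAdjoint B)
    (hD : A - B = D₁ + D₂) (hD₁ : NuclearLE D₁ c) (hc : 0 ≤ c) (hα0 : 0 < α) (hα1 : α < 1)
    (hC : 0 ≤ C) (n : ℕ) (hδ : 0 < δ) (hf : HoelderWith C α f) (hM : ∀ x, ‖f x‖ ≤ M) :
    KyFanLE n (opFun (cauchySmooth δ f) A - opFun (cauchySmooth δ f) B)
      (C * cauchyMoment α * 2 ^ α * δ ^ (α - 1) / (1 - 2 ^ (α - 1)) * (c + n * ‖D₂‖)) := by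
  refine KyFanLE.of_tendsto (fun N =>
    kyFanLE_cauchySmooth_of_hoelderWith_aux hA hB hD hD₁ hc hα0 hα1 hC n N hδ hf hM) ?_
  have h := ((tendsto_pow_atTop_nhds_zero_of_lt_one (r := (1 / 2 : ℝ)) (by norm_num)
    (by norm_num)).const_mul (M / δ)).const_add
      (C * cauchyMoment α * 2 ^ α * δ ^ (α - 1) / (1 - 2 ^ (α - 1)))
  rw [mul_zero, add_zero] at h
  exact h.mul_const _

lemma kyFanLE_opFun_sub_of_bounded (hA : IsSelfAdjoint A) (hB : IsSelfAdjoint B)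
    (hD : A - B = D₁ + D₂) (hD₁ : NuclearLE D₁ c) (hc : 0 ≤ c) (hα0 : 0 < α) (hα1 : α < 1)
    (hC : 0 ≤ C) (n : ℕ) (hδ : 0 < δ) (hf : HoelderWith C α f) (hM : ∀ x, ‖f x‖ ≤ M) :
    KyFanLE n (opFun f A - opFun f B)
      (C * cauchyMoment α * 2 ^ α * δ ^ (α - 1) / (1 - 2 ^ (α - 1)) * (c + n * ‖D₂‖)
        + n * (C * cauchyMoment α * δ ^ α + C * cauchyMoment α * δ ^ α)) := by
  have hfc := hf.continuous hα0
  have hcc := continuous_cauchySmooth hfc hM δ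
  have hle : ∀ S : H →L[ℂ] H, ‖opFun (f - cauchySmooth δ f) S‖ ≤ C * cauchyMoment α * δ ^ α :=
    norm_opFun_le fun x => hf.norm_sub_cauchySmooth_le hα0 hα1 hM hδ.le x
  have h := (kyFanLE_cauchySmooth_of_hoelderWith hA hB hD hD₁ hc hα0 hα1 hC n hδ hf hM).add
    (kyFanLE_of_norm_le (n := n) ((norm_sub_le _ _).trans (add_le_add (hle A) (hle B))))
  convert h using 1
  rw [opFun_sub_fun hfc hcc, opFun_sub_fun hfc hcc]
  abel

/-- Clamping the argument turns a Hölder function into a bounded one. -/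
lemma HoelderWith.comp_clamp (hf : HoelderWith C α f) (hC : 0 ≤ C) (hα0 : 0 < α) {R : ℝ} :
    HoelderWith C α fun x => f (max (-R) (min R x)) := by
  intro x y
  refine (hf _ _).trans ?_
  have h1 : |max (-R) (min R x) - max (-R) (min R y)| ≤ |x - y| :=
    (abs_max_sub_max_le_max _ _ _ _).trans (by
      rw [sub_self, abs_zero, max_eq_right (abs_nonneg _)]
      refine (abs_min_sub_min_le_max _ _ _ _).trans ?_
      rw [sub_self, abs_zero, max_eq_right (abs_nonneg _)])
  gcongr

lemma kyFanLE_opFun_sub (hA : IsSelfAdjoint A) (hB : IsSelfAdjoint B)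
    (hD : A - B = D₁ + D₂) (hD₁ : NuclearLE D₁ c) (hc : 0 ≤ c) (hα0 : 0 < α) (hα1 : α < 1)
    (hC : 0 ≤ C) (n : ℕ) (hδ : 0 < δ) (hf : HoelderWith C α f) :
    KyFanLE n (opFun f A - opFun f B)
      (C * cauchyMoment α * 2 ^ α * δ ^ (α - 1) / (1 - 2 ^ (α - 1)) * (c + n * ‖D₂‖)
        + n * (C * cauchyMoment α * δ ^ α + C * cauchyMoment α * δ ^ α)) := by
  obtain ⟨RA, hRA⟩ := exists_abs_re_le_of_mem_spectrum A
  obtain ⟨RB, hRB⟩ := exists_abs_re_le_of_mem_spectrum B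
  set R := max 0 (max RA RB) with hR
  have hR0 : 0 ≤ R := le_max_left _ _
  have hfg : ∀ x : ℝ, |x| ≤ R → f x = f (max (-R) (min R x)) := fun x hx => by
    rw [min_eq_right (abs_le.1 hx).2, max_eq_right (abs_le.1 hx).1]
  have hM : ∀ x, ‖f (max (-R) (min R x))‖ ≤ ‖f 0‖ + C * R ^ α := fun x => by
    have h1 : |max (-R) (min R x) - 0| ≤ R := by
      rw [sub_zero, abs_le]
      exact ⟨le_max_left _ _, max_le (by linarith) (min_le_left _ _)⟩
    have h2 := hf (max (-R) (min R x)) 0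
    have h3 : C * |max (-R) (min R x) - 0| ^ α ≤ C * R ^ α := by gcongr
    have h4 := norm_le_insert' (f (max (-R) (min R x))) (f 0)
    linarith
  have hcongr : ∀ S : H →L[ℂ] H, (∀ z ∈ spectrum ℂ S, |z.re| ≤ R) →
      opFun f S = opFun (fun x => f (max (-R) (min R x))) S := fun S hS =>
    cfc_congr fun z hz => hfg z.re (hS z hz)
  rw [hcongr A fun z hz => (hRA z hz).trans ((le_max_left _ _).trans (le_max_right _ _)),
    hcongr B fun z hz => (hRB z hz).trans ((le_max_right _ _).trans (le_max_right _ _))]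
  exact kyFanLE_opFun_sub_of_bounded hA hB hD hD₁ hc hα0 hα1 hC n hδ (hf.comp_clamp hC hα0) hM

end

/-! ### Singular values of `f(A) - f(B)` -/

/-- The constant in the estimate of the singular values of `f(A) - f(B)` for a function `f` of
Hölder order `α`. -/
def hoelderSValConst (α : ℝ) : ℝ :=
  cauchyMoment α * 2 ^ α / (1 - 2 ^ (α - 1)) + 2 * cauchyMoment α

lemma hoelderSValConst_nonneg {α : ℝ} (hα1 : α < 1) : 0 ≤ hoelderSValConst α := by
  have hq : (2 : ℝ) ^ (α - 1) < 1 := Real.rpow_lt_one_of_one_lt_of_neg one_lt_two (by linarith)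
  have hmom := cauchyMoment_nonneg α
  exact add_nonneg (div_nonneg (by positivity) (by linarith)) (by positivity)

/-- The averages `2⁻ᵐ ∑_{k ≤ m} 2ᵏ aₖ`. -/
def dyadicMean (a : ℕ → ℝ) (m : ℕ) : ℝ := (∑ k ∈ Finset.range (m + 1), 2 ^ k * a k) / 2 ^ m

lemma dyadicMean_nonneg {a : ℕ → ℝ} (ha : ∀ k, 0 ≤ a k) (m : ℕ) : 0 ≤ dyadicMean a m :=
  div_nonneg (Finset.sum_nonneg fun k _ => mul_nonneg (by positivity) (ha k)) (by positivity)

lemma dyadicMean_zero (a : ℕ → ℝ) : dyadicMean a 0 = a 0 := by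
  simp [dyadicMean]

lemma dyadicMean_succ (a : ℕ → ℝ) (m : ℕ) :
    dyadicMean a (m + 1) = dyadicMean a m / 2 + a (m + 1) := by
  rw [dyadicMean, dyadicMean, Finset.sum_range_succ, add_div, mul_div_cancel_left₀ _ (by positivity),
    pow_succ, div_div]

lemma sVal_opFun_sub_le_aux {A B : H →L[ℂ] H} (hA : IsSelfAdjoint A) (hB : IsSelfAdjoint B)
    {C α : ℝ} (hα0 : 0 < α) (hα1 : α < 1) (hC : 0 ≤ C) {f : ℝ → ℂ} (hf : HoelderWith C α f)
    (m : ℕ) {ε : ℝ} (hε : 0 < ε) :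
    sVal (opFun f A - opFun f B) (2 * (2 ^ m - 1))
      ≤ C * hoelderSValConst α *
        (6 * dyadicMean (fun k => sVal (A - B) (2 ^ k - 1) + ε) m) ^ α := by
  obtain ⟨D₁, D₂, hD, hD₂, hD₁⟩ := exists_nuclear_decomposition (A - B) hε m
  set a : ℕ → ℝ := fun k => sVal (A - B) (2 ^ k - 1) + ε with ha
  have ha0 : ∀ k, 0 < a k := fun k => add_pos_of_nonneg_of_pos (sVal_nonneg _ _) hε
  set δ := 6 * dyadicMean a m with hδ
  have hδ0 : 0 < δ := mul_pos (by norm_num) (div_pos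
    (Finset.sum_pos (fun k _ => mul_pos (by positivity) (ha0 k)) (by simp)) (by positivity))
  have hq : (2 : ℝ) ^ (α - 1) < 1 := Real.rpow_lt_one_of_one_lt_of_neg one_lt_two (by linarith)
  have hmom := cauchyMoment_nonneg α
  have hK := hoelderSValConst_nonneg hα1
  have hc : 0 ≤ 6 * ∑ k ∈ Finset.range m, 2 ^ k * a k :=
    mul_nonneg (by norm_num) (Finset.sum_nonneg fun k _ => mul_nonneg (by positivity) (ha0 k).le)
  have hκ : 6 * ∑ k ∈ Finset.range m, 2 ^ k * a k + ((2 ^ m : ℕ) : ℝ) * ‖D₂‖ ≤ 2 ^ m * δ := by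
    have e : 2 ^ m * δ = 6 * ∑ k ∈ Finset.range m, 2 ^ k * a k + 6 * (2 ^ m * a m) := by
      rw [hδ, dyadicMean, Finset.sum_range_succ]
      field_simp
    rw [e]
    push_cast
    have h1 : (2 : ℝ) ^ m * ‖D₂‖ ≤ 2 ^ m * a m := by gcongr
    have h2 : 0 ≤ 2 ^ m * a m := mul_nonneg (by positivity) (ha0 m).le
    linarith
  have hKF := kyFanLE_opFun_sub hA hB hD hD₁ hc hα0 hα1 hC (2 ^ m) hδ0 hf
  have hKF' : KyFanLE (2 ^ m - 1 + 1) (opFun f A - opFun f B)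
      (2 ^ m * (C * hoelderSValConst α * δ ^ α)) := by
    rw [Nat.sub_add_cancel Nat.one_le_two_pow]
    refine hKF.mono ?_
    have hcoef : 0 ≤ C * cauchyMoment α * 2 ^ α * δ ^ (α - 1) / (1 - 2 ^ (α - 1)) :=
      div_nonneg (by positivity) (by linarith)
    refine (add_le_add (mul_le_mul_of_nonneg_left hκ hcoef) le_rfl).trans_eq ?_
    rw [Real.rpow_sub_one hδ0.ne' α, hoelderSValConst]
    push_cast
    field_simp
    ring
  refine (hKF'.sVal_le (by positivity)).trans_eq ?_
  rw [Nat.cast_sub Nat.one_le_two_pow]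
  push_cast
  rw [sub_add_cancel, mul_div_cancel_left₀ _ (by positivity)]

lemma sVal_opFun_sub_le {A B : H →L[ℂ] H} (hA : IsSelfAdjoint A) (hB : IsSelfAdjoint B)
    {C α : ℝ} (hα0 : 0 < α) (hα1 : α < 1) (hC : 0 ≤ C) {f : ℝ → ℂ} (hf : HoelderWith C α f)
    (m : ℕ) :
    sVal (opFun f A - opFun f B) (2 * (2 ^ m - 1))
      ≤ C * hoelderSValConst α *
        (6 * dyadicMean (fun k => sVal (A - B) (2 ^ k - 1)) m) ^ α := by
  have hcont : Continuous fun ε : ℝ => C * hoelderSValConst α *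
      (6 * dyadicMean (fun k => sVal (A - B) (2 ^ k - 1) + ε) m) ^ α := by
    refine continuous_const.mul (Continuous.rpow_const ?_ fun _ => Or.inr hα0.le)
    unfold dyadicMean
    fun_prop
  have h := (hcont.tendsto 0).mono_left (nhdsWithin_le_nhds (s := Set.Ioi 0))
  simp only [add_zero] at h
  exact ge_of_tendsto h (Filter.eventually_of_mem self_mem_nhdsWithin fun ε hε =>
    sVal_opFun_sub_le_aux hA hB hα0 hα1 hC hf m hε)

/-! ### Dyadic sums -/

lemma sum_dyadic_le_two_mul_sum {g : ℕ → ℝ} (hg : Antitone g) (hg0 : ∀ j, 0 ≤ g j) (N : ℕ) :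
    ∑ k ∈ Finset.range (N + 1), 2 ^ k * g (2 ^ k - 1) ≤ 2 * ∑ j ∈ Finset.range (2 ^ N), g j := by
  induction N with
  | zero => simpa using by linarith [hg0 0]
  | succ N ih =>
    have e : 2 ^ (N + 1) = 2 ^ N + 2 ^ N := by rw [pow_succ, mul_two]
    rw [Finset.sum_range_succ, e, Finset.sum_range_add g, mul_add]
    refine add_le_add ih ?_
    have h : ∑ _j ∈ Finset.range (2 ^ N), g (2 ^ N + 2 ^ N - 1)
        ≤ ∑ j ∈ Finset.range (2 ^ N), g (2 ^ N + j) :=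
      Finset.sum_le_sum fun j hj => hg (by have := Finset.mem_range.1 hj; omega)
    rw [Finset.sum_const, Finset.card_range, nsmul_eq_mul] at h
    push_cast at h
    rw [pow_succ]
    linarith

lemma sum_range_le_sum_dyadic {g : ℕ → ℝ} (hg : Antitone g) (N : ℕ) :
    ∑ j ∈ Finset.range (2 * (2 ^ N - 1)), g j
      ≤ ∑ m ∈ Finset.range N, 2 ^ (m + 1) * g (2 * (2 ^ m - 1)) := by
  induction N with
  | zero => simp
  | succ N ih =>
    have e : 2 * (2 ^ (N + 1) - 1) = 2 * (2 ^ N - 1) + 2 ^ (N + 1) := by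
      have := Nat.one_le_two_pow (n := N)
      rw [pow_succ]
      omega
    rw [e, Finset.sum_range_add, Finset.sum_range_succ]
    refine add_le_add ih ?_
    have h : ∑ j ∈ Finset.range (2 ^ (N + 1)), g (2 * (2 ^ N - 1) + j)
        ≤ ∑ _j ∈ Finset.range (2 ^ (N + 1)), g (2 * (2 ^ N - 1)) :=
      Finset.sum_le_sum fun j _ => hg (by omega)
    rw [Finset.sum_const, Finset.card_range, nsmul_eq_mul] at h
    exact_mod_cast h

lemma sum_le_of_le_mul_add {W b : ℕ → ℝ} {ρ : ℝ} (hρ0 : 0 ≤ ρ) (hW : ∀ m, 0 ≤ W m)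
    (h0 : W 0 ≤ b 0) (hs : ∀ m, W (m + 1) ≤ ρ * W m + b (m + 1)) (N : ℕ) :
    (1 - ρ) * ∑ m ∈ Finset.range (N + 1), W m ≤ ∑ m ∈ Finset.range (N + 1), b m := by
  have key : ∀ N, ∑ m ∈ Finset.range (N + 1), W m
      ≤ ρ * ∑ m ∈ Finset.range N, W m + ∑ m ∈ Finset.range (N + 1), b m := by
    intro N
    induction N with
    | zero => simpa using h0
    | succ N ih =>
      rw [Finset.sum_range_succ W (N + 1), Finset.sum_range_succ b (N + 1),
        Finset.sum_range_succ W N, mul_add]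
      rw [Finset.sum_range_succ W N] at ih
      linarith [hs N]
  have h1 := key N
  have h2 : ρ * ∑ m ∈ Finset.range N, W m ≤ ρ * ∑ m ∈ Finset.range (N + 1), W m := by
    rw [Finset.sum_range_succ]
    gcongr
    linarith [hW N]
  linarith

/-- A discrete Hardy inequality. -/
lemma sum_dyadicMean_rpow_le {a : ℕ → ℝ} (ha : ∀ k, 0 ≤ a k) {p : ℝ} (hp : 1 < p) (N : ℕ) :
    (1 - (3 / 2 : ℝ) ^ (1 - p)) * ∑ m ∈ Finset.range (N + 1), 2 ^ m * dyadicMean a m ^ p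
      ≤ 4 ^ (p - 1) * ∑ k ∈ Finset.range (N + 1), 2 ^ k * a k ^ p := by
  have hw := dyadicMean_nonneg ha
  rw [Finset.mul_sum (Finset.range (N + 1)) (fun k => 2 ^ k * a k ^ p)]
  refine sum_le_of_le_mul_add (W := fun m => 2 ^ m * dyadicMean a m ^ p)
    (b := fun k => 4 ^ (p - 1) * (2 ^ k * a k ^ p)) (by positivity)
    (fun m => mul_nonneg (by positivity) (Real.rpow_nonneg (hw m) _)) ?_ (fun m => ?_) N
  · have h4 : (1 : ℝ) ≤ 4 ^ (p - 1) := Real.one_le_rpow (by norm_num) (by linarith)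
    have := Real.rpow_nonneg (ha 0) p
    simp only [pow_zero, one_mul, dyadicMean_zero]
    nlinarith
  · have hconv := (convexOn_rpow hp.le).2 (Set.mem_Ici.2 (mul_nonneg (by norm_num) (hw m) :
        0 ≤ 2 / 3 * dyadicMean a m)) (Set.mem_Ici.2 (mul_nonneg (by norm_num) (ha _) :
        0 ≤ 4 * a (m + 1))) (by norm_num : (0 : ℝ) ≤ 3 / 4) (by norm_num : (0 : ℝ) ≤ 1 / 4)
        (by norm_num)
    simp only [smul_eq_mul] at hconv
    rw [Real.mul_rpow (by norm_num) (hw m), Real.mul_rpow (by norm_num) (ha _)] at hconv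
    have e1 : (2 / 3 : ℝ) ^ p = 2 / 3 * (3 / 2) ^ (1 - p) := by
      rw [show (3 / 2 : ℝ) = (2 / 3)⁻¹ by norm_num, Real.inv_rpow (by norm_num),
        ← Real.rpow_neg (by norm_num), neg_sub, Real.rpow_sub_one (by norm_num)]
      field_simp
    have e2 : (4 : ℝ) ^ p = 4 * 4 ^ (p - 1) := by
      rw [Real.rpow_sub_one (by norm_num)]
      field_simp
    have e3 : dyadicMean a (m + 1)
        = 3 / 4 * (2 / 3 * dyadicMean a m) + 1 / 4 * (4 * a (m + 1)) := by
      rw [dyadicMean_succ]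
      ring
    rw [e1, e2, ← e3] at hconv
    calc 2 ^ (m + 1) * dyadicMean a (m + 1) ^ p
        ≤ 2 ^ (m + 1) * _ := mul_le_mul_of_nonneg_left hconv (by positivity)
      _ = _ := by rw [pow_succ]; ring

/-! ### Schatten norm estimate -/

lemma hoelderWith_hoelderNorm {α : ℝ} {f : ℝ → ℂ} (hα : 0 < α) (hf : MemHoelder α f) :
    HoelderWith (hoelderNorm α f) α f := by
  intro x y
  rcases eq_or_ne x y with rfl | hxy
  · simp [Real.zero_rpow hα.ne']
  · have h : 0 < |x - y| ^ α := Real.rpow_pos_of_pos (abs_pos.2 (sub_ne_zero.2 hxy)) _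
    rw [← div_le_iff₀ h]
    exact le_csInf hf fun C hC => (div_le_iff₀ h).2 (hC.2 x y)

lemma hoelderNorm_nonneg (α : ℝ) (f : ℝ → ℂ) : 0 ≤ hoelderNorm α f :=
  Real.sInf_nonneg fun _ h => h.1

/-- The constant in the estimate of `∑ⱼ sⱼ(f(A) - f(B)) ^ (p / α)`. -/
def schattenSumConst (p : ℝ) : ℝ := 4 * 6 ^ p * 4 ^ (p - 1) / (1 - (3 / 2 : ℝ) ^ (1 - p))

lemma schattenSumConst_nonneg {p : ℝ} (hp : 1 < p) : 0 ≤ schattenSumConst p := by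
  have hρ : (3 / 2 : ℝ) ^ (1 - p) < 1 :=
    Real.rpow_lt_one_of_one_lt_of_neg (by norm_num) (by linarith)
  exact div_nonneg (by positivity) (by linarith)

lemma sum_sVal_opFun_sub_rpow_le {A B : H →L[ℂ] H} (hA : IsSelfAdjoint A) (hB : IsSelfAdjoint B)
    {C α p : ℝ} (hα0 : 0 < α) (hα1 : α < 1) (hp : 1 < p) (hC : 0 ≤ C) {f : ℝ → ℂ}
    (hf : HoelderWith C α f) (hAB : MemSchatten p (A - B)) (n : ℕ) :
    ∑ j ∈ Finset.range n, sVal (opFun f A - opFun f B) j ^ (p / α)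
      ≤ (C * hoelderSValConst α) ^ (p / α) *
        (schattenSumConst p * ∑' j, sVal (A - B) j ^ p) := by
  set T := opFun f A - opFun f B
  set a : ℕ → ℝ := fun k => sVal (A - B) (2 ^ k - 1) with ha
  have hp0 : 0 < p := by linarith
  have hr0 : 0 ≤ p / α := by positivity
  have hK := hoelderSValConst_nonneg hα1
  have ha0 : ∀ k, 0 ≤ a k := fun k => sVal_nonneg _ _
  have hρ : 0 < 1 - (3 / 2 : ℝ) ^ (1 - p) := by
    linarith [Real.rpow_lt_one_of_one_lt_of_neg (x := (3 / 2 : ℝ)) (z := 1 - p) (by norm_num)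
      (by linarith)]
  have hanti : ∀ (S : H →L[ℂ] H) {r : ℝ}, 0 ≤ r → Antitone fun j => sVal S j ^ r :=
    fun S r hr i j hij => Real.rpow_le_rpow (sVal_nonneg _ _) (sVal_antitone S hij) hr
  have hn : n ≤ 2 * (2 ^ (n + 1) - 1) := by
    have := Nat.lt_two_pow_self (n := n)
    rw [pow_succ]
    omega
  have hterm : ∀ m, sVal T (2 * (2 ^ m - 1)) ^ (p / α)
      ≤ (C * hoelderSValConst α) ^ (p / α) * 6 ^ p * dyadicMean a m ^ p := fun m => by
    have hw := dyadicMean_nonneg ha0 m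
    calc sVal T (2 * (2 ^ m - 1)) ^ (p / α)
        ≤ (C * hoelderSValConst α * (6 * dyadicMean a m) ^ α) ^ (p / α) :=
          Real.rpow_le_rpow (sVal_nonneg _ _) (sVal_opFun_sub_le hA hB hα0 hα1 hC hf m) hr0
      _ = _ := by
        rw [Real.mul_rpow (by positivity) (by positivity), ← Real.rpow_mul (by positivity),
          mul_div_cancel₀ _ hα0.ne', Real.mul_rpow (by norm_num) hw]
        ring
  have hhardy : ∑ m ∈ Finset.range (n + 1), 2 ^ m * dyadicMean a m ^ p
      ≤ 4 ^ (p - 1) / (1 - (3 / 2 : ℝ) ^ (1 - p)) * (2 * ∑' j, sVal (A - B) j ^ p) := by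
    rw [div_mul_eq_mul_div, le_div_iff₀' hρ]
    refine (sum_dyadicMean_rpow_le ha0 hp n).trans ?_
    refine mul_le_mul_of_nonneg_left ?_ (by positivity)
    refine (sum_dyadic_le_two_mul_sum (hanti (A - B) hp0.le)
      (fun j => Real.rpow_nonneg (sVal_nonneg _ _) _) n).trans ?_
    exact mul_le_mul_of_nonneg_left
      (hAB.sum_le_tsum _ fun j _ => Real.rpow_nonneg (sVal_nonneg _ _) _) two_pos.le
  calc ∑ j ∈ Finset.range n, sVal T j ^ (p / α)
      ≤ ∑ j ∈ Finset.range (2 * (2 ^ (n + 1) - 1)), sVal T j ^ (p / α) :=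
        Finset.sum_le_sum_of_subset_of_nonneg (Finset.range_mono hn)
          fun j _ _ => Real.rpow_nonneg (sVal_nonneg _ _) _
    _ ≤ ∑ m ∈ Finset.range (n + 1), 2 ^ (m + 1) * sVal T (2 * (2 ^ m - 1)) ^ (p / α) :=
        sum_range_le_sum_dyadic (hanti T hr0) (n + 1)
    _ ≤ ∑ m ∈ Finset.range (n + 1), 2 ^ (m + 1) *
          ((C * hoelderSValConst α) ^ (p / α) * 6 ^ p * dyadicMean a m ^ p) :=
        Finset.sum_le_sum fun m _ => mul_le_mul_of_nonneg_left (hterm m) (by positivity)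
    _ = 2 * ((C * hoelderSValConst α) ^ (p / α) * 6 ^ p) *
          ∑ m ∈ Finset.range (n + 1), 2 ^ m * dyadicMean a m ^ p := by
        rw [Finset.mul_sum]
        exact Finset.sum_congr rfl fun m _ => by rw [pow_succ]; ring
    _ ≤ 2 * ((C * hoelderSValConst α) ^ (p / α) * 6 ^ p) *
          (4 ^ (p - 1) / (1 - (3 / 2 : ℝ) ^ (1 - p)) * (2 * ∑' j, sVal (A - B) j ^ p)) :=
        mul_le_mul_of_nonneg_left hhardy (by positivity)
    _ = _ := by rw [schattenSumConst]; ring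

end SchattenHoelder

theorem stmt4 (α p : ℝ) (hα0 : 0 < α) (hα1 : α < 1) (hp1 : 1 < p) :
    ∃ c : ℝ, 0 < c ∧
      ∀ (H : Type) [NormedAddCommGroup H] [InnerProductSpace ℂ H] [CompleteSpace H]
        [TopologicalSpace.SeparableSpace H],
        ∀ f : ℝ → ℂ, MemHoelder α f →
        ∀ A B : H →L[ℂ] H, IsSelfAdjoint A → IsSelfAdjoint B →
          MemSchatten p (A - B) →
            MemSchatten (p / α) (opFun f A - opFun f B) ∧
            schNorm (p / α) (opFun f A - opFun f B) ≤
              c * hoelderNorm α f * schNorm p (A - B) ^ α := by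
  have hK := hoelderSValConst_nonneg hα1
  have hL := schattenSumConst_nonneg hp1
  have hp0 : 0 < p := by linarith
  refine ⟨hoelderSValConst α * schattenSumConst p ^ (α / p) + 1, by positivity, ?_⟩
  intro H _ _ _ _ f hf A B hA hB hAB
  have hC := hoelderNorm_nonneg α f
  have hS : 0 ≤ ∑' j, sVal (A - B) j ^ p := tsum_nonneg fun j => Real.rpow_nonneg (sVal_nonneg _ _) _
  have hsum := sum_sVal_opFun_sub_rpow_le hA hB hα0 hα1 hp1 hC (hoelderWith_hoelderNorm hα0 hf) hAB
  have hnn : ∀ j, 0 ≤ sVal (opFun f A - opFun f B) j ^ (p / α) :=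
    fun j => Real.rpow_nonneg (sVal_nonneg _ _) _
  refine ⟨summable_of_sum_range_le hnn hsum, ?_⟩
  have hle := Real.tsum_le_of_sum_range_le hnn hsum
  calc schNorm (p / α) (opFun f A - opFun f B)
      ≤ ((hoelderNorm α f * hoelderSValConst α) ^ (p / α) *
          (schattenSumConst p * ∑' j, sVal (A - B) j ^ p)) ^ (1 / (p / α)) :=
        Real.rpow_le_rpow (tsum_nonneg hnn) hle (by positivity)
    _ = hoelderSValConst α * schattenSumConst p ^ (α / p) * hoelderNorm α f
          * schNorm p (A - B) ^ α := by
        rw [schNorm, ← Real.rpow_mul hS, Real.mul_rpow (by positivity) (by positivity),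
          ← Real.rpow_mul (by positivity), mul_one_div_cancel (by positivity), Real.rpow_one,
          Real.mul_rpow hL hS, one_div_div, one_div_mul_eq_div]
        ring
    _ ≤ _ := by
        have : 0 ≤ schNorm p (A - B) ^ α := Real.rpow_nonneg (Real.rpow_nonneg hS _) _
        gcongr
        linarith
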